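/- Let m < n be positive integers, let E ⊂ ℝⁿ be purely m-unrectifiable, let P : ℝⁿ → ℝ^m be Lipschitz continuous, and let δ > 0. Define E₁ := {a ∈ E : limsup_{s→0} sup_{0<r<δ} (rs)^{−m} H^m(E ∩ X(a,r,s)) = 0}. Then H^m(E₁) = 0. -/

import Mathlib

open MeasureTheory Set Metric Filter ENNReal

/-- The truncated cone `X(a,r,s) = {x : |P x - P a| < s |x - a|} ∩ B(a,r)` around the preimage
`P⁻¹(P a)`. -/
def coneX {n m : ℕ} (P : EuclideanSpace ℝ (Fin n) → EuclideanSpace ℝ (Fin m))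
    (a : EuclideanSpace ℝ (Fin n)) (r s : ℝ) : Set (EuclideanSpace ℝ (Fin n)) :=
  {x | ‖P x - P a‖ < s * ‖x - a‖} ∩ Metric.closedBall a r

/-- `limsup_{s → 0+} sup_{0 < r < δ} (r s)^{-m} H^m (A ∩ X(a,r,s))`. -/
noncomputable def coneDensity {n m' : ℕ} (m : ℕ)
    (P : EuclideanSpace ℝ (Fin n) → EuclideanSpace ℝ (Fin m'))
    (A : Set (EuclideanSpace ℝ (Fin n))) (a : EuclideanSpace ℝ (Fin n)) (δ : ℝ) : ℝ≥0∞ :=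
  Filter.limsup
    (fun s : ℝ => ⨆ r ∈ Set.Ioo (0 : ℝ) δ,
      (ENNReal.ofReal ((r * s) ^ m))⁻¹ * μH[m] (A ∩ coneX P a r s))
    (nhdsWithin 0 (Set.Ioi 0))

/-- A set `A ⊆ ℝⁿ` is purely `m`-unrectifiable if `H^m (A ∩ f(ℝ^m)) = 0` for every
Lipschitz map `f : ℝ^m → ℝⁿ`. -/
def PurelyUnrectifiable (m n : ℕ) (A : Set (EuclideanSpace ℝ (Fin n))) : Prop :=
  ∀ f : EuclideanSpace ℝ (Fin m) → EuclideanSpace ℝ (Fin n),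
    (∃ K : NNReal, LipschitzWith K f) → μH[m] (A ∩ Set.range f) = 0

theorem PurelyUnrectifiable.mono {m n : ℕ} {A B : Set (EuclideanSpace ℝ (Fin n))}
    (hB : PurelyUnrectifiable m n B) (hAB : A ⊆ B) : PurelyUnrectifiable m n A :=
  fun f hf => measure_mono_null (inter_subset_inter_left _ hAB) (hB f hf)

/-- A purely unrectifiable set on which some map to `ℝ^m` has a Lipschitz inverse is null. -/
theorem PurelyUnrectifiable.measure_eq_zero_of_expanding {m n : ℕ}
    {G : Set (EuclideanSpace ℝ (Fin n))} (hG : PurelyUnrectifiable m n G)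
    {P : EuclideanSpace ℝ (Fin n) → EuclideanSpace ℝ (Fin m)} {t : ℝ} (ht : 0 < t)
    (h : ∀ a ∈ G, ∀ x ∈ G, t * ‖x - a‖ ≤ ‖P x - P a‖) : μH[m] G = 0 := by
  have hinj : InjOn P G := by
    intro x hx a ha hxa
    have h' := h a ha x hx
    rw [hxa, sub_self, norm_zero] at h'
    have h0 : ‖x - a‖ ≤ 0 := nonpos_of_mul_nonpos_right h' ht
    exact sub_eq_zero.1 (norm_le_zero_iff.1 h0)
  have hinv : LeftInvOn (Function.invFunOn P G) P G := hinj.leftInvOn_invFunOn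
  have hLip : LipschitzOnWith (Real.toNNReal t⁻¹) (Function.invFunOn P G) (P '' G) := by
    apply LipschitzOnWith.of_dist_le_mul
    rintro _ ⟨x, hx, rfl⟩ _ ⟨a, ha, rfl⟩
    rw [hinv hx, hinv ha, dist_eq_norm, dist_eq_norm, Real.coe_toNNReal _ (inv_pos.2 ht).le,
      ← div_eq_inv_mul, le_div_iff₀ ht, mul_comm]
    exact h a ha x hx
  obtain ⟨g, hg, hgeq⟩ := hLip.extend_finite_dimension
  have hsub : G ⊆ G ∩ range g := fun x hx =>
    ⟨hx, P x, by rw [← hgeq (mem_image_of_mem P hx), hinv hx]⟩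
  exact measure_mono_null hsub (hG g ⟨_, hg⟩)

/-- In a bounded set, a nonempty cone with vertex `a` contains a point whose distance to `a` is
almost maximal. -/
theorem exists_almost_farthest_point_of_cone {m n : ℕ} {F : Set (EuclideanSpace ℝ (Fin n))}
    {P : EuclideanSpace ℝ (Fin n) → EuclideanSpace ℝ (Fin m)} {a : EuclideanSpace ℝ (Fin n)}
    {t D : ℝ} (hD : ∀ x ∈ F, ‖x - a‖ ≤ D) (hne : ∃ x ∈ F, ‖P x - P a‖ < t * ‖x - a‖) :
    ∃ h : ℝ, 0 < h ∧ h ≤ D ∧ (∀ x ∈ F, ‖P x - P a‖ < t * ‖x - a‖ → ‖x - a‖ ≤ h) ∧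
      ∃ b ∈ F, ‖P b - P a‖ < t * ‖b - a‖ ∧ 3 / 4 * h ≤ ‖b - a‖ := by
  set S : Set ℝ := (fun x => ‖x - a‖) '' {x ∈ F | ‖P x - P a‖ < t * ‖x - a‖}
  obtain ⟨x₀, hx₀, hx₀'⟩ := hne
  have hSne : S.Nonempty := ⟨_, x₀, ⟨hx₀, hx₀'⟩, rfl⟩
  have hSle : ∀ y ∈ S, y ≤ D := by
    rintro _ ⟨x, hx, rfl⟩
    exact hD x hx.1
  have hle : ∀ x ∈ F, ‖P x - P a‖ < t * ‖x - a‖ → ‖x - a‖ ≤ sSup S :=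
    fun x hx hx' => le_csSup ⟨D, hSle⟩ ⟨x, ⟨hx, hx'⟩, rfl⟩
  have hpos : 0 < sSup S := by
    refine lt_of_lt_of_le (norm_pos_iff.2 fun h0 => ?_) (hle x₀ hx₀ hx₀')
    rw [h0, norm_zero, mul_zero] at hx₀'
    exact absurd hx₀' (norm_nonneg _).not_gt
  obtain ⟨_, ⟨b, hb, rfl⟩, hb'⟩ := exists_lt_of_lt_csSup hSne
    (show 3 / 4 * sSup S < sSup S by linarith)
  exact ⟨sSup S, hpos, csSup_le hSne hSle, hle, b, hb.1, hb.2, hb'.le⟩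

/-- If the points of `F` in the cone at `a` of aperture `s / 4` have distance at most `h` to `a`
and `b` is one of them with almost maximal distance, then the part of `F` in the tube around the
fibre through `a` of width `s h / 4` is contained in the cones at `a` and `b` of aperture `s`. -/
theorem tube_subset_union_coneX {m n : ℕ} {F : Set (EuclideanSpace ℝ (Fin n))}
    {P : EuclideanSpace ℝ (Fin n) → EuclideanSpace ℝ (Fin m)} {a b : EuclideanSpace ℝ (Fin n)}
    {s h : ℝ} (hs : 0 < s) (hh : 0 < h)
    (hmax : ∀ x ∈ F, ‖P x - P a‖ < s / 4 * ‖x - a‖ → ‖x - a‖ ≤ h) (hb : b ∈ F)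
    (hba : ‖P b - P a‖ < s / 4 * ‖b - a‖) (hfar : 3 / 4 * h ≤ ‖b - a‖) :
    F ∩ P ⁻¹' closedBall (P a) (s * h / 4) ⊆
      F ∩ coneX P a (2 * h) s ∪ F ∩ coneX P b (2 * h) s := by
  rintro x ⟨hxF, hx⟩
  rw [mem_preimage, mem_closedBall, dist_eq_norm] at hx
  have hxa : ‖x - a‖ ≤ h := by
    by_contra! hlt
    have := hmax x hxF (by nlinarith)
    linarith
  have hbah : ‖b - a‖ ≤ h := hmax b hb hba
  by_cases hcone : ‖P x - P a‖ < s * ‖x - a‖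
  · refine Or.inl ⟨hxF, hcone, ?_⟩
    rw [mem_closedBall, dist_eq_norm]
    linarith
  · push Not at hcone
    have hxa' : ‖x - a‖ ≤ h / 4 := by
      have : s * ‖x - a‖ ≤ s * (h / 4) := by linarith
      exact le_of_mul_le_mul_left this hs
    have hfar' : ‖b - a‖ ≤ ‖x - b‖ + ‖x - a‖ := by
      rw [norm_sub_rev x b]
      exact norm_sub_le_norm_sub_add_norm_sub b x a
    have hnear : ‖x - b‖ ≤ ‖x - a‖ + ‖b - a‖ := by
      rw [norm_sub_rev b a]
      exact norm_sub_le_norm_sub_add_norm_sub x a b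
    have hP : ‖P x - P b‖ ≤ ‖P x - P a‖ + ‖P b - P a‖ := by
      rw [norm_sub_rev (P b)]
      exact norm_sub_le_norm_sub_add_norm_sub _ _ _
    refine Or.inr ⟨hxF, ?_, ?_⟩
    · have h1 : s * (h / 2) ≤ s * ‖x - b‖ := mul_le_mul_of_nonneg_left (by linarith) hs.le
      have h2 : s / 4 * ‖b - a‖ ≤ s / 4 * h := mul_le_mul_of_nonneg_left hbah (by positivity)
      show ‖P x - P b‖ < s * ‖x - b‖
      linarith
    · rw [mem_closedBall, dist_eq_norm]
      linarith

/-- A purely unrectifiable set contained in a small ball and having small measure in all cones of a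
fixed aperture has small measure. -/
theorem PurelyUnrectifiable.measure_le_of_cone_le {m n : ℕ}
    {F : Set (EuclideanSpace ℝ (Fin n))} (hF : PurelyUnrectifiable m n F)
    {P : EuclideanSpace ℝ (Fin n) → EuclideanSpace ℝ (Fin m)} {K : NNReal}
    (hP : LipschitzWith K P) {x₀ : EuclideanSpace ℝ (Fin n)} {ρ δ s : ℝ} (hρδ : 4 * ρ < δ)
    (hFρ : F ⊆ closedBall x₀ ρ) (hs : 0 < s) (hs1 : s ≤ 1) {ε : ℝ≥0∞}
    (hcone : ∀ a ∈ F, ∀ r ∈ Ioo 0 δ,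
      μH[m] (F ∩ coneX P a r s) ≤ ε * ENNReal.ofReal ((r * s) ^ m)) :
    μH[m] F * volume (ball (0 : EuclideanSpace ℝ (Fin m)) 1) ≤
      ε * (2 * 40 ^ m * volume (closedBall (P x₀) (K * ρ + 2 * ρ))) := by
  set F' : Set (EuclideanSpace ℝ (Fin n)) :=
    {a ∈ F | ∃ x ∈ F, ‖P x - P a‖ < s / 4 * ‖x - a‖}
  have hF'F : F' ⊆ F := sep_subset _ _
  have hnull : μH[m] (F \ F') = 0 := by
    refine (hF.mono sdiff_subset).measure_eq_zero_of_expanding (P := P) (t := s / 4)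
      (by positivity) fun a ha x hx => ?_
    by_contra! hlt
    exact ha.2 ⟨ha.1, x, hx.1, hlt⟩
  have hdiam : ∀ a ∈ F, ∀ x ∈ F, ‖x - a‖ ≤ 2 * ρ := by
    intro a ha x hx
    rw [← dist_eq_norm]
    have h1 := mem_closedBall.1 (hFρ ha)
    have h2 := mem_closedBall.1 (hFρ hx)
    have h3 := dist_triangle_right x a x₀
    linarith
  have hexists := fun a (ha : a ∈ F') =>
    exists_almost_farthest_point_of_cone (hdiam a (hF'F ha)) ha.2
  choose! h hpos hle hmax b hb hba hfar using hexists
  have htube : ∀ a ∈ F', μH[m] (F ∩ P ⁻¹' closedBall (P a) (s * h a / 4)) ≤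
      ε * (2 * 40 ^ m) * ENNReal.ofReal ((s * h a / 20) ^ m) := by
    intro a ha
    have hr : 2 * h a ∈ Ioo 0 δ :=
      ⟨by linarith [hpos a ha], by linarith [hle a ha]⟩
    have hscale : ENNReal.ofReal ((2 * h a * s) ^ m) =
        40 ^ m * ENNReal.ofReal ((s * h a / 20) ^ m) := by
      rw [show 2 * h a * s = 40 * (s * h a / 20) by ring, mul_pow,
        ENNReal.ofReal_mul (by positivity), ENNReal.ofReal_pow (by norm_num)]
      norm_num
    calc μH[m] (F ∩ P ⁻¹' closedBall (P a) (s * h a / 4))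
        ≤ μH[m] (F ∩ coneX P a (2 * h a) s) + μH[m] (F ∩ coneX P (b a) (2 * h a) s) :=
          (measure_mono (tube_subset_union_coneX hs (hpos a ha) (hmax a ha) (hb a ha)
            (hba a ha) (hfar a ha))).trans (measure_union_le _ _)
      _ ≤ ε * ENNReal.ofReal ((2 * h a * s) ^ m) + ε * ENNReal.ofReal ((2 * h a * s) ^ m) :=
          add_le_add (hcone a (hF'F ha) _ hr) (hcone _ (hb a ha) _ hr)
      _ = _ := by rw [hscale]; ring
  have hrad : ∀ a ∈ F', s * h a / 20 ≤ 2 * ρ := by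
    intro a ha
    nlinarith [hpos a ha, hle a ha]
  obtain ⟨u, hu, hdisj, hcover⟩ := Vitali.exists_disjoint_subfamily_covering_enlargement_closedBall
    F' P (fun a => s * h a / 20) (2 * ρ) hrad 5 (by norm_num)
  have hradpos : ∀ a ∈ F', 0 < s * h a / 20 := by
    intro a ha
    have := hpos a ha
    positivity
  have hucount : u.Countable := hdisj.countable_of_nonempty_interior fun a ha =>
    ⟨P a, ball_subset_interior_closedBall (mem_ball_self (hradpos a (hu ha)))⟩
  have : Countable u := hucount.to_subtype
  have hvol : ∑' a : u, ENNReal.ofReal ((s * h a / 20) ^ m) *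
      volume (ball (0 : EuclideanSpace ℝ (Fin m)) 1) ≤
        volume (closedBall (P x₀) (K * ρ + 2 * ρ)) := by
    calc _ = ∑' a : u, volume (closedBall (P a) (s * h a / 20)) := by
          congr 1 with a
          rw [Measure.addHaar_closedBall _ _ (hradpos a (hu a.2)).le, finrank_euclideanSpace_fin]
      _ ≤ volume (⋃ a : u, closedBall (P a) (s * h a / 20)) :=
          tsum_meas_le_meas_iUnion_of_disjoint _ (fun _ => measurableSet_closedBall)
            (hdisj.subtype _ _)
      _ ≤ _ := by
          refine measure_mono (iUnion_subset fun a => closedBall_subset_closedBall' ?_)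
          have h1 : dist (P a) (P x₀) ≤ K * ρ := (hP.dist_le_mul _ _).trans
            (mul_le_mul_of_nonneg_left (mem_closedBall.1 (hFρ (hF'F (hu a.2)))) K.2)
          linarith [hrad a (hu a.2)]
  have hF'cover : F' ⊆ ⋃ a : u, F ∩ P ⁻¹' closedBall (P a) (s * h a / 4) := by
    intro x hx
    obtain ⟨a, ha, hxa⟩ := hcover x hx
    refine mem_iUnion.2 ⟨⟨a, ha⟩, hF'F hx, ?_⟩
    have := hxa (mem_closedBall_self (hradpos x hx).le)
    rwa [show 5 * (s * h a / 20) = s * h a / 4 by ring] at this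
  calc μH[m] F * volume (ball (0 : EuclideanSpace ℝ (Fin m)) 1)
      ≤ (∑' a : u, ε * (2 * 40 ^ m) * ENNReal.ofReal ((s * h a / 20) ^ m)) *
          volume (ball (0 : EuclideanSpace ℝ (Fin m)) 1) := by
        gcongr
        calc μH[m] F ≤ μH[m] F' + μH[m] (F \ F') :=
              (measure_mono (union_sdiff_cancel hF'F).ge).trans (measure_union_le _ _)
          _ ≤ ∑' a : u, μH[m] (F ∩ P ⁻¹' closedBall (P a) (s * h a / 4)) := by
              rw [hnull, add_zero]
              exact (measure_mono hF'cover).trans (measure_iUnion_le _)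
          _ ≤ _ := ENNReal.tsum_le_tsum fun a => htube a (hu a.2)
    _ = ε * (2 * 40 ^ m) * ∑' a : u, ENNReal.ofReal ((s * h a / 20) ^ m) *
          volume (ball (0 : EuclideanSpace ℝ (Fin m)) 1) := by
        rw [ENNReal.tsum_mul_left, ENNReal.tsum_mul_right, mul_assoc]
    _ ≤ ε * (2 * 40 ^ m) * volume (closedBall (P x₀) (K * ρ + 2 * ρ)) := by gcongr
    _ = _ := by ring

/-- Vanishing upper cone density gives uniform cone bounds for all small apertures `1 / (j + 1)`. -/
theorem exists_forall_cone_le_of_coneDensity_eq_zero {m n : ℕ}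
    {P : EuclideanSpace ℝ (Fin n) → EuclideanSpace ℝ (Fin m)}
    {E : Set (EuclideanSpace ℝ (Fin n))} {a : EuclideanSpace ℝ (Fin n)} {δ : ℝ}
    (ha : coneDensity m P E a δ = 0) {ε : ℝ≥0∞} (hε : 0 < ε) :
    ∃ k : ℕ, ∀ j ≥ k, ∀ r ∈ Ioo 0 δ, μH[m] (E ∩ coneX P a r (1 / ((j : ℝ) + 1))) ≤
      ε * ENNReal.ofReal ((r * (1 / ((j : ℝ) + 1))) ^ m) := by
  have hev := eventually_lt_of_limsup_lt (show coneDensity m P E a δ < ε from ha ▸ hε)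
  have hlim : Tendsto (fun j : ℕ => 1 / ((j : ℝ) + 1)) atTop (nhdsWithin 0 (Ioi 0)) :=
    tendsto_nhdsWithin_iff.2 ⟨tendsto_one_div_add_atTop_nhds_zero_nat,
      Eventually.of_forall fun j => by rw [mem_Ioi]; positivity⟩
  obtain ⟨k, hk⟩ := eventually_atTop.1 (hlim.eventually hev)
  refine ⟨k, fun j hj r hr => ?_⟩
  have hle := (le_iSup₂ (f := fun (r : ℝ) (_ : r ∈ Ioo 0 δ) =>
    (ENNReal.ofReal ((r * (1 / ((j : ℝ) + 1))) ^ m))⁻¹ *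
      μH[m] (E ∩ coneX P a r (1 / ((j : ℝ) + 1)))) r hr).trans (hk j hj).le
  have hpos : 0 < (r * (1 / ((j : ℝ) + 1))) ^ m := by
    have := hr.1
    positivity
  rwa [ENNReal.inv_mul_le_iff (ENNReal.ofReal_pos.2 hpos).ne' ENNReal.ofReal_ne_top,
    mul_comm] at hle

/-- If `E ⊆ ℝⁿ` is purely `m`-unrectifiable and `P : ℝⁿ → ℝ^m` is Lipschitz, then the set of
points `a ∈ E` where the upper cone density
`limsup_{s→0} sup_{0<r<δ} (rs)^{-m} H^m(E ∩ X(a,r,s))` vanishes is `H^m`-null. -/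
theorem hausdorff_null_of_cone_density_zero {m n : ℕ} (hm : 0 < m) (hmn : m < n)
    (E : Set (EuclideanSpace ℝ (Fin n))) (hE : PurelyUnrectifiable m n E)
    (P : EuclideanSpace ℝ (Fin n) → EuclideanSpace ℝ (Fin m))
    (hP : ∃ K : NNReal, LipschitzWith K P) (δ : ℝ) (hδ : 0 < δ) :
    μH[m] {a ∈ E | coneDensity m P E a δ = 0} = 0 := by
  obtain ⟨K, hK⟩ := hP
  set E₁ := {a ∈ E | coneDensity m P E a δ = 0}
  refine measure_null_of_locally_null _ fun x₀ _ => ⟨E₁ ∩ closedBall x₀ (δ / 5),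
    inter_mem self_mem_nhdsWithin (mem_nhdsWithin_of_mem_nhds
      (closedBall_mem_nhds _ (by positivity))), ?_⟩
  set C : ℝ≥0∞ := 2 * 40 ^ m * volume (closedBall (P x₀) (K * (δ / 5) + 2 * (δ / 5)))
  have hCtop : C ≠ ∞ := ENNReal.mul_ne_top
    (ENNReal.mul_ne_top ENNReal.ofNat_ne_top (ENNReal.pow_ne_top ENNReal.ofNat_ne_top))
    measure_closedBall_lt_top.ne
  have hball : volume (ball (0 : EuclideanSpace ℝ (Fin m)) 1) ≠ 0 :=
    (measure_ball_pos _ _ one_pos).ne'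
  have hbound : ∀ ε : ℝ≥0∞, 0 < ε → μH[m] (E₁ ∩ closedBall x₀ (δ / 5)) *
      volume (ball (0 : EuclideanSpace ℝ (Fin m)) 1) ≤ ε * C := by
    intro ε hε
    let F : ℕ → Set (EuclideanSpace ℝ (Fin n)) := fun k =>
      {a ∈ E ∩ closedBall x₀ (δ / 5) | ∀ j ≥ k, ∀ r ∈ Ioo 0 δ,
        μH[m] (E ∩ coneX P a r (1 / ((j : ℝ) + 1))) ≤
          ε * ENNReal.ofReal ((r * (1 / ((j : ℝ) + 1))) ^ m)}
    have hFE : ∀ k, F k ⊆ E := fun k a ha => ha.1.1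
    have hmono : Monotone F := fun k l hkl a ha => ⟨ha.1, fun j hj => ha.2 j (hkl.trans hj)⟩
    have hsub : E₁ ∩ closedBall x₀ (δ / 5) ⊆ ⋃ k, F k := by
      rintro a ⟨⟨haE, ha⟩, haB⟩
      obtain ⟨k, hk⟩ := exists_forall_cone_le_of_coneDensity_eq_zero ha hε
      exact mem_iUnion.2 ⟨k, ⟨haE, haB⟩, hk⟩
    calc _ ≤ (⨆ k, μH[m] (F k)) * volume (ball (0 : EuclideanSpace ℝ (Fin m)) 1) := by
          rw [← hmono.measure_iUnion]
          gcongr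
      _ ≤ ε * C := by
          rw [ENNReal.iSup_mul]
          refine iSup_le fun k => (hE.mono (hFE k)).measure_le_of_cone_le hK (δ := δ)
            (s := 1 / ((k : ℝ) + 1)) (by linarith) (fun a ha => ha.1.2) (by positivity) ?_ ?_
          · rw [div_le_one (by positivity)]
            linarith [(Nat.cast_nonneg k : (0 : ℝ) ≤ k)]
          · exact fun a ha r hr => (measure_mono (inter_subset_inter_left _ (hFE k))).trans
              (ha.2 k le_rfl r hr)
  have hzero : μH[m] (E₁ ∩ closedBall x₀ (δ / 5)) *
      volume (ball (0 : EuclideanSpace ℝ (Fin m)) 1) = 0 := by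
    have hlim : Tendsto (fun ε : ℝ≥0∞ => ε * C) (nhdsWithin 0 (Ioi 0)) (nhds 0) := by
      have := ENNReal.Tendsto.mul_const (b := C)
        (tendsto_id.mono_left (nhdsWithin_le_nhds (a := (0 : ℝ≥0∞)) (s := Ioi 0))) (Or.inr hCtop)
      simpa using this
    exact le_antisymm (ge_of_tendsto hlim (eventually_mem_nhdsWithin.mono hbound)) zero_le
  exact (mul_eq_zero.1 hzero).resolve_right hball
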